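/- Under the odd-case construction, C(π_A) ≥ (k+1-ε) · min_π C(π), where the minimum is over all bijections π of {1,...,k}. -/

import Mathlib

/-!
Odd-case construction: k ≥ 3 odd, 0 < ε ≤ 1.  Servers s_1,...,s_k at positions
0,...,k-1 (s_i at position i-1).  ε_i = (ε/8)·2^(i-k) for i < k and ε_k = 1/2.
Requests (1-indexed): r_{2j-1} = ((k-1)/2 + j - 1) + 1/2 - ε_{2j-1} for
j = 1,...,(k+1)/2 and r_{2j} = ((k-1)/2 - j) + 1/2 + ε_{2j} for
j = 1,...,(k-1)/2.  A matching is a function f : ℕ → ℕ sending each request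
index i ∈ {1,...,k} to a server index f i ∈ {1,...,k} (at position f i - 1);
its cost is C(f) = ∑_{i=1}^k |r_i - (f i - 1)|.
-/

/-- `ε_i`: equals `(ε/8)·2^(i-k)` for `i < k` and `1/2` for `i = k`. -/
noncomputable def eps (k : ℕ) (ε : ℝ) (i : ℕ) : ℝ :=
  if i = k then 1 / 2 else ε / 8 * (2 : ℝ) ^ ((i : ℤ) - (k : ℤ))

/-- The request `r_i` (1-indexed, `1 ≤ i ≤ k`): writing `i = 2j-1` or `i = 2j`,
`r_{2j-1} = ((k-1)/2 + j - 1) + 1/2 - ε_{2j-1}` and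
`r_{2j} = ((k-1)/2 - j) + 1/2 + ε_{2j}`. -/
noncomputable def req (k : ℕ) (ε : ℝ) (i : ℕ) : ℝ :=
  if i % 2 = 1 then
    (((k : ℝ) - 1) / 2 + (((i + 1) / 2 : ℕ) : ℝ) - 1) + 1 / 2 - eps k ε i
  else (((k : ℝ) - 1) / 2 - ((i / 2 : ℕ) : ℝ)) + 1 / 2 + eps k ε i

/-- Cost of the matching sending request `i` to server `f i` (position `f i - 1`). -/
noncomputable def cost (k : ℕ) (ε : ℝ) (f : ℕ → ℕ) : ℝ :=
  ∑ i ∈ Finset.Icc 1 k, |req k ε i - ((f i : ℝ) - 1)|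

/-- The permutation algorithm's matching `π_A`:
`π_A(2j-1) = (k+1)/2 - j + 1`, `π_A(2j) = (k+1)/2 + j`. -/
def piA (k : ℕ) (i : ℕ) : ℕ :=
  if i % 2 = 1 then (k + 1) / 2 - (i + 1) / 2 + 1 else (k + 1) / 2 + i / 2

/-- The offline matching `π_B`:
`π_B(2j-1) = (k-1)/2 + j`, `π_B(2j) = (k-1)/2 - j + 1`. -/
def piB (k : ℕ) (i : ℕ) : ℕ :=
  if i % 2 = 1 then (k - 1) / 2 + (i + 1) / 2 else (k - 1) / 2 - i / 2 + 1

theorem sum_Icc_two_pow (n : ℕ) :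
    ∑ i ∈ Finset.Icc 1 n, (2 : ℝ) ^ i = 2 ^ (n + 1) - 2 := by
  induction n with
  | zero => norm_num
  | succ n ih => rw [Finset.sum_Icc_succ_top (by omega), ih]; ring

theorem sum_Icc_sub_half (n : ℕ) :
    ∑ i ∈ Finset.Icc 1 n, ((i : ℝ) - 1 / 2) = (n : ℝ) ^ 2 / 2 := by
  induction n with
  | zero => norm_num
  | succ n ih => rw [Finset.sum_Icc_succ_top (by omega), ih]; push_cast; ring

theorem eps_self (k : ℕ) (ε : ℝ) : eps k ε k = 1 / 2 := by
  simp [eps]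

theorem eps_of_ne {k i : ℕ} (ε : ℝ) (h : i ≠ k) :
    eps k ε i = ε / 8 / 2 ^ k * 2 ^ i := by
  rw [eps, if_neg h, zpow_sub₀ two_ne_zero, zpow_natCast, zpow_natCast]
  ring

theorem sum_eps_le (n : ℕ) {ε : ℝ} (hε : 0 ≤ ε) :
    ∑ i ∈ Finset.Icc 1 n, eps (n + 1) ε i ≤ ε / 8 := by
  have h : ∀ i ∈ Finset.Icc 1 n, eps (n + 1) ε i = ε / 8 / 2 ^ (n + 1) * 2 ^ i := by
    intro i hi
    rw [Finset.mem_Icc] at hi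
    exact eps_of_ne ε (by omega)
  rw [Finset.sum_congr rfl h, ← Finset.mul_sum, sum_Icc_two_pow, div_mul_eq_mul_div,
    div_le_iff₀ (by positivity)]
  nlinarith

theorem eps_nonneg (k i : ℕ) {ε : ℝ} (hε : 0 ≤ ε) : 0 ≤ eps k ε i := by
  unfold eps
  split_ifs <;> positivity

theorem eps_le_half {k i : ℕ} {ε : ℝ} (hε : 0 ≤ ε) (hε1 : ε ≤ 1) (hi : i ≤ k) :
    eps k ε i ≤ 1 / 2 := by
  rcases eq_or_ne i k with rfl | h
  · exact (eps_self i ε).le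
  · have h2 : (2 : ℝ) ^ i ≤ 2 ^ k := pow_le_pow_right₀ one_le_two hi
    rw [eps_of_ne ε h, div_mul_eq_mul_div, div_le_iff₀ (by positivity)]
    have : (0 : ℝ) < 2 ^ k := by positivity
    nlinarith

theorem le_abs_req_sub_piA {m i : ℕ} (ε : ℝ) (hi : i ≤ 2 * m + 1) :
    (i : ℝ) - 1 / 2 - eps (2 * m + 1) ε i ≤
      |req (2 * m + 1) ε i - ((piA (2 * m + 1) i : ℝ) - 1)| := by
  rcases Nat.even_or_odd' i with ⟨j, rfl | rfl⟩
  · rw [abs_sub_comm]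
    refine le_trans (le_of_eq ?_) (le_abs_self _)
    have hA : piA (2 * m + 1) (2 * j) = m + 1 + j := by
      unfold piA; split_ifs <;> omega
    rw [hA, req, if_neg (by omega), show 2 * j / 2 = j by omega]
    push_cast
    ring
  · refine le_trans (le_of_eq ?_) (le_abs_self _)
    have hA : piA (2 * m + 1) (2 * j + 1) = m - j + 1 := by
      unfold piA; split_ifs <;> omega
    rw [hA, req, if_pos (by omega), show (2 * j + 1 + 1) / 2 = j + 1 by omega]
    push_cast [Nat.cast_sub (show j ≤ m by omega)]
    ring

theorem abs_req_sub_piB_of_even {m j : ℕ} {ε : ℝ} (hε : 0 ≤ ε) (hj : j ≤ m) :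
    |req (2 * m + 1) ε (2 * j) - ((piB (2 * m + 1) (2 * j) : ℝ) - 1)| =
      1 / 2 + eps (2 * m + 1) ε (2 * j) := by
  have h0 := eps_nonneg (2 * m + 1) (2 * j) hε
  have hB : piB (2 * m + 1) (2 * j) = m - j + 1 := by
    unfold piB; split_ifs <;> omega
  rw [← abs_of_nonneg (show 0 ≤ 1 / 2 + eps (2 * m + 1) ε (2 * j) by linarith),
    hB, req, if_neg (by omega), show 2 * j / 2 = j by omega]
  push_cast [Nat.cast_sub hj]
  congr 1
  ring

theorem abs_req_sub_piB_of_odd {m j : ℕ} {ε : ℝ} (hε : 0 ≤ ε) (hε1 : ε ≤ 1) (hj : j ≤ m) :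
    |req (2 * m + 1) ε (2 * j + 1) - ((piB (2 * m + 1) (2 * j + 1) : ℝ) - 1)| =
      1 / 2 - eps (2 * m + 1) ε (2 * j + 1) := by
  have h0 := eps_le_half hε hε1 (show 2 * j + 1 ≤ 2 * m + 1 by omega)
  have hB : piB (2 * m + 1) (2 * j + 1) = m + j + 1 := by
    unfold piB; split_ifs <;> omega
  rw [← abs_of_nonneg (sub_nonneg.2 h0), hB, req, if_pos (by omega),
    show (2 * j + 1 + 1) / 2 = j + 1 by omega]
  push_cast
  congr 1
  ring

theorem le_cost_piA (m : ℕ) (ε : ℝ) :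
    (2 * (m : ℝ) + 2) * m - ∑ i ∈ Finset.Icc 1 (2 * m), eps (2 * m + 1) ε i ≤
      cost (2 * m + 1) ε (piA (2 * m + 1)) := by
  calc _ = ∑ i ∈ Finset.Icc 1 (2 * m + 1), ((i : ℝ) - 1 / 2 - eps (2 * m + 1) ε i) := by
        rw [Finset.sum_sub_distrib, sum_Icc_sub_half,
          Finset.sum_Icc_succ_top (by omega), eps_self]
        push_cast
        ring
    _ ≤ _ := Finset.sum_le_sum fun i hi => le_abs_req_sub_piA ε (Finset.mem_Icc.1 hi).2

theorem cost_piB_le (m : ℕ) {ε : ℝ} (hε : 0 ≤ ε) (hε1 : ε ≤ 1) :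
    cost (2 * m + 1) ε (piB (2 * m + 1)) ≤
      m + ∑ i ∈ Finset.Icc 1 (2 * m), eps (2 * m + 1) ε i := by
  rw [cost, Finset.sum_Icc_succ_top (by omega), abs_req_sub_piB_of_odd hε hε1 le_rfl, eps_self,
    sub_self, add_zero]
  calc _ ≤ ∑ i ∈ Finset.Icc 1 (2 * m), (1 / 2 + eps (2 * m + 1) ε i) := by
        refine Finset.sum_le_sum fun i hi => ?_
        rw [Finset.mem_Icc] at hi
        rcases Nat.even_or_odd' i with ⟨j, rfl | rfl⟩
        · exact (abs_req_sub_piB_of_even hε (by omega)).le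
        · rw [abs_req_sub_piB_of_odd hε hε1 (by omega)]
          linarith [eps_nonneg (2 * m + 1) (2 * j + 1) hε]
    _ = _ := by
        rw [Finset.sum_add_distrib, Finset.sum_const, Nat.card_Icc, nsmul_eq_mul]
        push_cast [Nat.add_sub_cancel]
        ring

theorem bijOn_piB (m : ℕ) :
    Set.BijOn (piB (2 * m + 1)) (Set.Icc 1 (2 * m + 1)) (Set.Icc 1 (2 * m + 1)) := by
  refine ⟨fun i hi => ?_, fun i hi j hj h => ?_, fun y hy => ?_⟩
  · rw [Set.mem_Icc] at hi ⊢
    unfold piB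
    split_ifs <;> omega
  · rw [Set.mem_Icc] at hi hj
    unfold piB at h
    split_ifs at h <;> omega
  · rw [Set.mem_Icc] at hy
    rcases le_or_gt y m with h | h
    · refine ⟨2 * (m + 1 - y), Set.mem_Icc.2 (by omega), ?_⟩
      unfold piB
      split_ifs <;> omega
    · refine ⟨2 * (y - m) - 1, Set.mem_Icc.2 (by omega), ?_⟩
      unfold piB
      split_ifs <;> omega

theorem cost_nonneg (k : ℕ) (ε : ℝ) (f : ℕ → ℕ) : 0 ≤ cost k ε f :=
  Finset.sum_nonneg fun _ _ => abs_nonneg _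

/-- Odd case: C(π_A) ≥ (k+1-ε) · min over all bijections π of {1,...,k} of C(π). -/
theorem odd_ratio (k : ℕ) (hk : 3 ≤ k) (hko : Odd k)
    (ε : ℝ) (hε : 0 < ε) (hε1 : ε ≤ 1) :
    cost k ε (piA k) ≥
      ((k : ℝ) + 1 - ε) *
        sInf {c : ℝ | ∃ g : ℕ → ℕ,
          Set.BijOn g (Set.Icc 1 k) (Set.Icc 1 k) ∧ c = cost k ε g} := by
  obtain ⟨m, rfl⟩ := hko
  have hm : (1 : ℝ) ≤ m := by exact_mod_cast (show 1 ≤ m by omega)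
  have hinf : sInf {c : ℝ | ∃ g : ℕ → ℕ,
      Set.BijOn g (Set.Icc 1 (2 * m + 1)) (Set.Icc 1 (2 * m + 1)) ∧ c = cost (2 * m + 1) ε g} ≤
      cost (2 * m + 1) ε (piB (2 * m + 1)) :=
    csInf_le ⟨0, by rintro c ⟨g, -, rfl⟩; exact cost_nonneg _ _ _⟩ ⟨_, bijOn_piB m, rfl⟩
  have hA := le_cost_piA m ε
  have hB := hinf.trans (cost_piB_le m hε.le hε1)
  have hS := sum_eps_le (2 * m) hε.le
  have hS0 : 0 ≤ ∑ i ∈ Finset.Icc 1 (2 * m), eps (2 * m + 1) ε i :=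
    Finset.sum_nonneg fun i _ => eps_nonneg _ i hε.le
  set S := ∑ i ∈ Finset.Icc 1 (2 * m), eps (2 * m + 1) ε i
  push_cast
  refine (mul_le_mul_of_nonneg_left hB (by linarith)).trans (le_trans ?_ hA)
  have h1 : (2 * (m : ℝ) + 3) * S ≤ (2 * (m : ℝ) + 3) * (ε / 8) :=
    mul_le_mul_of_nonneg_left hS (by linarith)
  nlinarith [mul_nonneg hε.le hS0, mul_nonneg hε.le (sub_nonneg.2 hm)]
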